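/- arXiv:2207.14582 — 2 statements merged into one kernel-verified Lean document; each statement's English description precedes it below -/
import Mathlib

section
/- Let n ≥ 2, p > 1 and β > 0 with β^{1/(p−1)} ≥ (n−1)/(p−1). Then the function R ↦ E_{β,p}(B_1, B_R) is non-increasing on [1, +∞). -/
open MeasureTheory Metric Set Filter
open scoped ENNReal NNReal Topology

noncomputable section

/-- Abbreviation for `n`-dimensional Euclidean space. -/
abbrev En (n : ℕ) := EuclideanSpace ℝ (Fin n)

/-- A stand-in notion of "Lipschitz boundary": near each boundary point, the boundary is
the injective Lipschitz image of a subset of `ℝ^(n-1)`. -/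
def HasLipschitzBoundary {n : ℕ} (s : Set (En n)) : Prop :=
  ∀ x ∈ frontier s, ∃ U : Set (En n), IsOpen U ∧ x ∈ U ∧
    ∃ (f : EuclideanSpace ℝ (Fin (n - 1)) → En n) (V : Set (EuclideanSpace ℝ (Fin (n - 1))))
      (L : ℝ≥0), LipschitzOnWith L f V ∧ Set.InjOn f V ∧ f '' V = frontier s ∩ U

/-- The Robin energy functional `∫_Ω |∇v|^p dx + β ∫_{∂Ω} |v|^p dH^{n-1}`. -/
def robinFunctional {n : ℕ} (p β : ℝ) (Ω : Set (En n)) (v : En n → ℝ) : ℝ :=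
  (∫ x in Ω, ‖gradient v x‖ ^ p) + β * ∫ x in frontier Ω, |v x| ^ p ∂(μH[(n : ℝ) - 1])

/-- Admissible competitors: Lipschitz functions equal to `1` on `K`. -/
def robinAdmissible {n : ℕ} (K : Set (En n)) : Set (En n → ℝ) :=
  {v | (∃ L : ℝ≥0, LipschitzWith L v) ∧ ∀ x ∈ K, v x = 1}

/-- The Robin `p`-capacitary energy `E_{β,p}(K, Ω)`. -/
def robinEnergy {n : ℕ} (p β : ℝ) (K Ω : Set (En n)) : ℝ :=
  sInf (robinFunctional p β Ω '' robinAdmissible K)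

/-- `u` is the minimizer of `E_{β,p}(K, Ω)`. -/
def IsRobinMinimizer {n : ℕ} (p β : ℝ) (K Ω : Set (En n)) (u : En n → ℝ) : Prop :=
  u ∈ robinAdmissible K ∧ robinFunctional p β Ω u = robinEnergy p β K Ω

/-- `ω_n`, the Lebesgue measure of the unit ball of `ℝⁿ`. -/
def unitBallVol (n : ℕ) : ℝ := (volume (ball (0 : En n) 1)).toReal

/-- The function `Φ_{p,n}`. -/
def Phi (p : ℝ) (n : ℕ) (ρ : ℝ) : ℝ :=
  if p = n then Real.log ρ
  else -((p - 1) / ((n : ℝ) - p)) * ρ ^ (-(((n : ℝ) - p) / (p - 1)))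

/-- The derivative `Φ'_{p,n}(ρ) = ρ^{-(n-1)/(p-1)}`. -/
def PhiDeriv (p : ℝ) (n : ℕ) (ρ : ℝ) : ℝ := ρ ^ (-(((n : ℝ) - 1) / (p - 1)))

/-- The denominator `Φ'_{p,n}(R) + β^{1/(p-1)} (Φ_{p,n}(R) - Φ_{p,n}(1))`. -/
def Dconst (n : ℕ) (p β R : ℝ) : ℝ :=
  PhiDeriv p n R + β ^ (1 / (p - 1)) * (Phi p n R - Phi p n 1)

/-- The radial profile of the minimizer `u*` on `(B_1, B_R)`. -/
def ustarProfile (n : ℕ) (p β R : ℝ) (ρ : ℝ) : ℝ :=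
  1 - β ^ (1 / (p - 1)) * max (Phi p n ρ - Phi p n 1) 0 / Dconst n p β R

/-- The explicit minimizer `u*` of `E_{β,p}(B_1, B_R)`. -/
def ustar (n : ℕ) (p β R : ℝ) (x : En n) : ℝ := ustarProfile n p β R ‖x‖

/-- The common value of `|∇u*|/u*` on the sphere `∂B_r`. -/
def gstar (n : ℕ) (p β R : ℝ) (r : ℝ) : ℝ :=
  |deriv (ustarProfile n p β R) r| / ustarProfile n p β R r

/-- The superlevel set `U_t = {x ∈ Ω : u x > t}`. -/
def superLevel {n : ℕ} (Ω : Set (En n)) (u : En n → ℝ) (t : ℝ) : Set (En n) :=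
  {x ∈ Ω | t < u x}

/-- The `H`-function of Bossel–Daners. -/
def Hfun {n : ℕ} (p β : ℝ) (Ω : Set (En n)) (u φ : En n → ℝ) (t : ℝ) : ℝ :=
  (∫ x in frontier (superLevel Ω u t) ∩ Ω, |φ x| ^ (p - 1) ∂(μH[(n : ℝ) - 1]))
    - (p - 1) * (∫ x in superLevel Ω u t, |φ x| ^ p)
    + β * (μH[(n : ℝ) - 1] (frontier (superLevel Ω u t) ∩ frontier Ω)).toReal

/-- The radius `r(t)` such that `|B_{r(t)}| = |U_t|`. -/
def levelRadius {n : ℕ} (Ω : Set (En n)) (u : En n → ℝ) (t : ℝ) : ℝ :=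
  ((volume (superLevel Ω u t)).toReal / unitBallVol n) ^ ((1 : ℝ) / n)

/-- The essential (measure-theoretic) boundary of a set, a measure-theoretic substitute for
the reduced boundary (they agree up to `H^{n-1}`-negligible sets for sets of finite
perimeter, by Federer's theorem). -/
def essentialBoundary {n : ℕ} (U : Set (En n)) : Set (En n) :=
  {x | ¬ Tendsto (fun r => volume (U ∩ closedBall x r) / volume (closedBall x r))
        (𝓝[>] (0 : ℝ)) (𝓝 0) ∧
       ¬ Tendsto (fun r => volume (U ∩ closedBall x r) / volume (closedBall x r))
        (𝓝[>] (0 : ℝ)) (𝓝 1)}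

/-- An admissible pair `(K, Ω)` for the shape optimization problem with volume bound `M`. -/
def AdmissiblePair {n : ℕ} (M : ℝ) (K Ω : Set (En n)) : Prop :=
  IsCompact K ∧ HasLipschitzBoundary K ∧ IsOpen Ω ∧ Bornology.IsBounded Ω ∧
    HasLipschitzBoundary Ω ∧ K ⊆ closure Ω ∧
    (volume K).toReal = unitBallVol n ∧ (volume Ω).toReal ≤ M


section

open Measure
open scoped Pointwise

/-- Radial projection is `2`-Lipschitz outside the unit ball. -/
lemma lipschitzOnWith_inv_norm_smul {E : Type*} [NormedAddCommGroup E] [NormedSpace ℝ E] :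
    LipschitzOnWith 2 (fun x : E => ‖x‖⁻¹ • x) {x | 1 ≤ ‖x‖} := by
  refine LipschitzOnWith.of_dist_le_mul fun x hx y hy => ?_
  simp only [mem_ofPred_eq] at hx hy
  have hx0 : 0 < ‖x‖ := by linarith
  have hy0 : 0 < ‖y‖ := by linarith
  rw [dist_eq_norm, dist_eq_norm]
  have key : ‖x‖⁻¹ • x - ‖y‖⁻¹ • y = ‖x‖⁻¹ • (x - y) + (‖x‖⁻¹ - ‖y‖⁻¹) • y := by
    rw [smul_sub, sub_smul]; abel
  have h1 : ‖‖x‖⁻¹ • (x - y)‖ ≤ ‖x - y‖ := by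
    rw [norm_smul, norm_inv, norm_norm]
    exact mul_le_of_le_one_left (norm_nonneg _) (inv_le_one_of_one_le₀ hx)
  have h2 : ‖(‖x‖⁻¹ - ‖y‖⁻¹) • y‖ ≤ ‖x - y‖ := by
    have : (‖x‖⁻¹ - ‖y‖⁻¹) = ‖x‖⁻¹ * ((‖y‖ - ‖x‖) * ‖y‖⁻¹) := by field_simp
    rw [norm_smul, this, norm_mul, norm_mul, norm_inv, norm_inv, norm_norm, norm_norm]
    have h3 : ‖‖y‖ - ‖x‖‖ ≤ ‖x - y‖ := by
      rw [norm_sub_rev x y]; exact abs_norm_sub_norm_le y x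
    calc ‖x‖⁻¹ * (‖‖y‖ - ‖x‖‖ * ‖y‖⁻¹) * ‖y‖ = ‖x‖⁻¹ * ‖‖y‖ - ‖x‖‖ := by field_simp
      _ ≤ 1 * ‖x - y‖ := by
        gcongr
        exact inv_le_one_of_one_le₀ hx
      _ = _ := one_mul _
  calc _ ≤ ‖x - y‖ + ‖x - y‖ := by rw [key]; exact (norm_add_le _ _).trans (add_le_add h1 h2)
    _ = _ := by push_cast; ring

lemma hausdorffMeasure_fin_pi_real (m : ℕ) :
    (μH[(m : ℝ)] : Measure (Fin m → ℝ)) = volume := by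
  simpa using hausdorffMeasure_pi_real (ι := Fin m)

/-- The unit sphere of `ℝ^(m+1)` has finite `m`-dimensional Hausdorff measure. -/
lemma hausdorffMeasure_unitSphere_lt_top (m : ℕ) :
    μH[(m : ℝ)] (sphere (0 : En (m + 1)) 1) < ⊤ := by
  set face : Fin (m + 1) → ℝ → (Fin m → ℝ) → En (m + 1) :=
    fun i s y => WithLp.toLp 2 (Fin.insertNth i s y) with hface
  have hlip (i : Fin (m + 1)) (s : ℝ) :
      ∃ K, LipschitzWith K (face i s) := by
    have h1 := PiLp.lipschitzWith_toLp 2 (fun _ : Fin (m + 1) => ℝ)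
    have h2 : LipschitzWith 1 (fun y : Fin m → ℝ => (Fin.insertNth i s y : Fin (m + 1) → ℝ)) := by
      refine LipschitzWith.of_dist_le_mul fun y z => ?_
      rw [NNReal.coe_one, one_mul, dist_pi_le_iff dist_nonneg]
      intro j
      refine Fin.succAboveCases i ?_ (fun k => ?_) j
      · simp
      · simpa using dist_le_pi_dist y z k
    exact ⟨_, h1.comp h2⟩
  have hnorm (i : Fin (m + 1)) (s : ℝ) (hs : |s| = 1) (y : Fin m → ℝ) : 1 ≤ ‖face i s y‖ := by
    have := PiLp.norm_apply_le (face i s y) i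
    simpa [hface, hs] using this
  have hcover : sphere (0 : En (m + 1)) 1 ⊆ ⋃ i : Fin (m + 1), ⋃ s ∈ ({1, -1} : Finset ℝ),
      (fun y => ‖face i s y‖⁻¹ • face i s y) '' Icc (-1) 1 := by
    intro x hx
    have hx1 : ‖x‖ = 1 := by simpa using hx
    obtain ⟨i, -, hi⟩ := Finset.exists_max_image Finset.univ (fun i => |x i|) ⟨0, by simp⟩
    have hi0 : 0 < |x i| := by
      by_contra h
      have h0 : ∀ j, x j = 0 := fun j => by
        have := hi j (by simp)
        exact abs_eq_zero.1 (le_antisymm (by linarith) (abs_nonneg _))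
      have : x = 0 := by ext j; simp [h0 j]
      rw [this, norm_zero] at hx1
      exact zero_ne_one hx1
    simp only [mem_iUnion]
    have hf : face i (x i / |x i|) (fun k => x (i.succAbove k) / |x i|) = |x i|⁻¹ • x := by
      ext j
      refine Fin.succAboveCases i ?_ (fun k => ?_) j
      · simp [hface]; ring
      · simp [hface]; ring
    refine ⟨i, x i / |x i|, ?_, fun k => x (i.succAbove k) / |x i|, ?_, ?_⟩
    · rcases abs_choice (x i) with h | h
      · rw [h, div_self (by intro h0; simp [h0] at hi0)]; simp
      · rw [h, div_neg, div_self (by intro h0; simp [h0] at hi0)]; simp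
    · rw [mem_Icc, Pi.le_def, Pi.le_def]
      have hle : ∀ k, |x (i.succAbove k) / (|x i|)| ≤ 1 := by
        intro k
        rw [abs_div, abs_abs, div_le_one hi0]; exact hi _ (by simp)
      exact ⟨fun k => (abs_le.1 (hle k)).1, fun k => (abs_le.1 (hle k)).2⟩
    · simp only [hf, norm_smul, hx1, norm_inv, norm_abs_eq_norm, Real.norm_eq_abs, mul_one, inv_inv,
        smul_smul, mul_inv_cancel₀ hi0.ne', one_smul]
  refine (measure_mono hcover).trans_lt ?_
  refine (measure_iUnion_fintype_le _ _).trans_lt (ENNReal.sum_lt_top.2 fun i _ => ?_)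
  refine (measure_biUnion_finset_le _ _).trans_lt (ENNReal.sum_lt_top.2 fun s hs => ?_)
  obtain ⟨K, hK⟩ := hlip i s
  have hs1 : |s| = 1 := by
    rcases Finset.mem_insert.1 hs with rfl | h
    · simp
    · rw [Finset.mem_singleton.1 h]; simp
  have hl : LipschitzOnWith (2 * K) (fun y => ‖face i s y‖⁻¹ • face i s y) (Icc (-1) 1) :=
    (lipschitzOnWith_inv_norm_smul.comp hK.lipschitzOnWith fun y _ => hnorm i s hs1 y)
  refine (hl.hausdorffMeasure_image_le (Nat.cast_nonneg m)).trans_lt ?_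
  rw [hausdorffMeasure_fin_pi_real]
  exact ENNReal.mul_lt_top (ENNReal.rpow_lt_top_of_nonneg (Nat.cast_nonneg m) ENNReal.coe_ne_top)
    isCompact_Icc.measure_lt_top

/-- Two finite measures carried by the unit sphere, one absolutely continuous with respect to the
other, are proportional as soon as the masses of balls do not depend on the centre. -/
lemma exists_eq_smul_of_uniform {n : ℕ} (μ ρ : Measure (En n)) [IsFiniteMeasure μ]
    [IsFiniteMeasure ρ] (hρμ : ρ ≪ μ) (hμS : ∀ᵐ x ∂μ, ‖x‖ = 1)
    (hμ : ∀ x y : En n, ‖x‖ = 1 → ‖y‖ = 1 → ∀ r, μ (closedBall x r) = μ (closedBall y r))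
    (hρ : ∀ x y : En n, ‖x‖ = 1 → ‖y‖ = 1 → ∀ r, ρ (closedBall x r) = ρ (closedBall y r)) :
    ∃ k : ℝ≥0∞, ρ = k • μ := by
  rcases eq_or_ne μ 0 with rfl | hμ0
  · exact ⟨0, by simpa using hρμ⟩
  have hae := (Besicovitch.ae_tendsto_rnDeriv ρ μ).and hμS
  have : (ae μ).NeBot := ae_neBot.2 hμ0
  obtain ⟨x, hx, hx1⟩ := hae.exists
  refine ⟨ρ.rnDeriv μ x, ?_⟩
  have hconst : ρ.rnDeriv μ =ᵐ[μ] fun _ => ρ.rnDeriv μ x := by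
    filter_upwards [hae] with y ⟨hy, hy1⟩
    refine tendsto_nhds_unique hy (hx.congr fun r => ?_)
    rw [hμ x y hx1 hy1, hρ x y hx1 hy1]
  have := haveLebesgueDecomposition_of_sigmaFinite ρ μ
  conv_lhs => rw [← withDensity_rnDeriv_eq ρ μ hρμ, withDensity_congr_ae hconst, withDensity_const]

/-- The surface measure of the unit sphere, as a measure on the ambient space. -/
def surfaceMeasure (n : ℕ) : Measure (En n) :=
  (volume : Measure (En n)).toSphere.map (↑)

instance (n : ℕ) : IsFiniteMeasure (surfaceMeasure n) := by
  unfold surfaceMeasure; infer_instance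

lemma surfaceMeasure_apply {n : ℕ} {s : Set (En n)} (hs : MeasurableSet s) :
    surfaceMeasure n s = n * volume (Ioo (0 : ℝ) 1 • (s ∩ sphere 0 1)) := by
  rw [surfaceMeasure, map_apply measurable_subtype_coe hs,
    toSphere_apply' _ (measurable_subtype_coe hs), Subtype.image_preimage_coe, inter_comm]
  simp

/-- Any two points of the unit sphere are exchanged by a linear isometry. -/
lemma exists_linearIsometryEquiv_map_eq {n : ℕ} {x y : En n} (h : ‖x‖ = ‖y‖) :
    ∃ g : En n ≃ₗᵢ[ℝ] En n, g x = y :=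
  ⟨_, Submodule.reflection_sub h⟩

lemma surfaceMeasure_image {n : ℕ} (g : En n ≃ₗᵢ[ℝ] En n) {s : Set (En n)}
    (hs : MeasurableSet s) : surfaceMeasure n (g '' s) = surfaceMeasure n s := by
  have hgs : MeasurableSet (g '' s) :=
    (g.toHomeomorph.measurableEmbedding.measurableSet_image).2 hs
  have hS : g '' sphere 0 1 = sphere 0 1 := by
    simp
  rw [surfaceMeasure_apply hgs, surfaceMeasure_apply hs]
  congr 1
  have : Ioo (0 : ℝ) 1 • (g '' s ∩ sphere 0 1) = g '' (Ioo (0 : ℝ) 1 • (s ∩ sphere 0 1)) := by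
    conv_lhs => rw [← hS, ← image_inter g.injective]
    ext z
    simp only [Set.mem_smul, mem_image]
    constructor
    · rintro ⟨t, ht, _, ⟨w, hw, rfl⟩, rfl⟩
      exact ⟨t • w, ⟨t, ht, w, hw, rfl⟩, by simp⟩
    · rintro ⟨_, ⟨t, ht, w, hw, rfl⟩, rfl⟩
      exact ⟨t, ht, g w, ⟨w, hw, rfl⟩, by simp⟩
  rw [this, show g '' (Ioo (0 : ℝ) 1 • (s ∩ sphere 0 1)) =
    g.symm.toMeasurableEquiv ⁻¹' (Ioo (0 : ℝ) 1 • (s ∩ sphere 0 1)) from g.toEquiv.image_eq_preimage_symm _]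
  exact g.symm.measurePreserving.measure_preimage_equiv _

lemma ae_surfaceMeasure_norm_eq_one (n : ℕ) : ∀ᵐ x ∂surfaceMeasure n, ‖x‖ = 1 := by
  rw [surfaceMeasure, ae_map_iff measurable_subtype_coe.aemeasurable
    (measurableSet_eq_fun measurable_norm measurable_const)]
  exact Eventually.of_forall fun x => by simp

/-- A spherical cap around the first coordinate vector, with a square base. -/
def squareCap (m : ℕ) (s : ℝ) : Set (En (m + 1)) :=
  {x | ‖x‖ = 1 ∧ 0 < x 0 ∧ ∀ i : Fin m, |x i.succ| ≤ s * x 0}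

lemma measurableSet_squareCap (m : ℕ) (s : ℝ) : MeasurableSet (squareCap m s) := by
  have : {x : En (m + 1) | ∀ i : Fin m, |x i.succ| ≤ s * x 0} =
      ⋂ i : Fin m, {x | |x i.succ| ≤ s * x 0} := by ext; simp
  have hcoord (i : Fin (m + 1)) : Measurable fun x : En (m + 1) => x i := by fun_prop
  have hcap : squareCap m s = {x | ‖x‖ = 1} ∩ ({x | 0 < x 0} ∩
      ⋂ i : Fin m, {x | |x i.succ| ≤ s * x 0}) := by
    rw [← this]; rfl
  rw [hcap]
  exact (measurableSet_eq_fun measurable_norm measurable_const).inter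
    ((measurableSet_lt measurable_const (hcoord 0)).inter
      (MeasurableSet.iInter fun i => measurableSet_le
        (hcoord i.succ).abs ((hcoord 0).const_mul s)))

/-- The surface measure of a cap is at most the area of the square in which it is seen from the
centre on the tangent plane. -/
lemma surfaceMeasure_squareCap_le (m : ℕ) {s : ℝ} (hs : 0 ≤ s) :
    surfaceMeasure (m + 1) (squareCap m s) ≤ ENNReal.ofReal ((2 * s) ^ m) := by
  rw [surfaceMeasure_apply (measurableSet_squareCap m s)]
  set T : Set (ℝ × (Fin m → ℝ)) := {q | q.1 ∈ Ioo (0 : ℝ) 1 ∧ ∀ i, q.2 i ∈ Icc (-(s * q.1)) (s * q.1)}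
    with hT
  have hTm : MeasurableSet T := by
    have : T = (Prod.fst ⁻¹' Ioo (0 : ℝ) 1) ∩
        ⋂ i, ({q : ℝ × (Fin m → ℝ) | -(s * q.1) ≤ q.2 i} ∩ {q | q.2 i ≤ s * q.1}) := by ext; simp [hT]
    rw [this]
    exact (measurable_fst measurableSet_Ioo).inter (MeasurableSet.iInter fun i =>
      (measurableSet_le (by fun_prop) (by fun_prop)).inter
        (measurableSet_le (by fun_prop) (by fun_prop)))
  have hpres := (volume_preserving_piFinSuccAbove (fun _ : Fin (m + 1) => ℝ) 0).comp
    (EuclideanSpace.volume_preserving_symm_measurableEquiv_toLp (Fin (m + 1)))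
  have hsub : Ioo (0 : ℝ) 1 • (squareCap m s ∩ sphere 0 1) ⊆
      (MeasurableEquiv.piFinSuccAbove (fun _ : Fin (m + 1) => ℝ) 0 ∘
        (MeasurableEquiv.toLp 2 (Fin (m + 1) → ℝ)).symm) ⁻¹' T := by
    rintro _ ⟨t, ⟨ht0, ht1⟩, x, ⟨⟨hx1, hx0, hx⟩, -⟩, rfl⟩
    have hx01 : x 0 ≤ 1 := by
      have := PiLp.norm_apply_le x 0
      rw [hx1] at this
      exact (le_abs_self _).trans this
    refine ⟨⟨?_, ?_⟩, fun i => ?_⟩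
    · simpa using mul_pos ht0 hx0
    · have : t * x 0 < 1 := by nlinarith
      simpa using this
    · have : |t * x i.succ| ≤ s * (t * x 0) := by
        rw [abs_mul, abs_of_pos ht0]; nlinarith [hx i]
      simpa [Fin.tail, MeasurableEquiv.piFinSuccAbove] using abs_le.1 this
  have hvol : volume T ≤ ENNReal.ofReal ((2 * s) ^ m / (m + 1)) := by
    rw [volume_eq_prod, prod_apply hTm]
    have hslice : ∀ t, volume (Prod.mk t ⁻¹' T) =
        (Ioo (0 : ℝ) 1).indicator (fun t => ENNReal.ofReal ((2 * s) ^ m * t ^ m)) t := by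
      intro t
      by_cases ht : t ∈ Ioo (0 : ℝ) 1
      · have : Prod.mk t ⁻¹' T = Set.pi univ fun _ : Fin m => Icc (-(s * t)) (s * t) := by
          ext y
          simp only [hT, mem_preimage, mem_ofPred_eq, ht, true_and, Set.mem_pi, mem_univ,
            forall_const]
        rw [this, volume_pi_pi, indicator_of_mem ht]
        simp only [Real.volume_Icc, Finset.prod_const, Finset.card_univ, Fintype.card_fin]
        rw [← ENNReal.ofReal_pow (by nlinarith [ht.1])]
        congr 1
        rw [← mul_pow]; ring
      · have : Prod.mk t ⁻¹' T = ∅ := by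
          ext y
          simp only [hT, mem_preimage, mem_ofPred_eq, ht, false_and, mem_empty_iff_false]
        rw [this, measure_empty, indicator_of_notMem ht]
    simp only [hslice]
    rw [lintegral_indicator measurableSet_Ioo, restrict_congr_set Ioo_ae_eq_Ioc,
      ← ofReal_integral_eq_lintegral_ofReal, ← intervalIntegral.integral_of_le zero_le_one]
    · apply ENNReal.ofReal_le_ofReal
      simp [div_eq_mul_inv]
    · exact (Continuous.integrableOn_Icc (by fun_prop)).mono_set Ioc_subset_Icc_self
    · filter_upwards [ae_restrict_mem measurableSet_Ioc] with t ht
      have := ht.1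
      positivity
  calc _ ≤ ((m + 1 : ℕ) : ℝ≥0∞) * ENNReal.ofReal ((2 * s) ^ m / (m + 1)) := by
        gcongr
        exact (measure_mono hsub).trans
          ((hpres.measure_preimage hTm.nullMeasurableSet).trans_le hvol)
    _ = ENNReal.ofReal ((2 * s) ^ m) := by
        rw [← ENNReal.ofReal_natCast, ← ENNReal.ofReal_mul (by positivity)]
        congr 1
        push_cast
        field_simp

/-- The Hausdorff measure of a cap is at least the area of its orthogonal projection. -/
lemma le_hausdorffMeasure_squareCap (m : ℕ) {s : ℝ} (hs : 0 ≤ s) :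
    ENNReal.ofReal ((2 * (s / √(1 + m * s ^ 2))) ^ m) ≤
      μH[(m : ℝ)] (squareCap m s) := by
  set u := √(1 + m * s ^ 2) with hu
  have hu2 : u ^ 2 = 1 + m * s ^ 2 := Real.sq_sqrt (by positivity)
  have hu0 : 0 < u := Real.sqrt_pos.2 (by positivity)
  set π : En (m + 1) → (Fin m → ℝ) := fun x i => x i.succ with hπ
  have hlip : LipschitzWith 1 π := by
    refine LipschitzWith.of_dist_le_mul fun x y => ?_
    rw [NNReal.coe_one, one_mul, dist_pi_le_iff dist_nonneg]
    intro i
    have := PiLp.norm_apply_le (x - y) i.succ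
    simpa [dist_eq_norm, hπ] using this
  have hsub : (Icc (fun _ => -(s / u)) (fun _ => s / u) : Set (Fin m → ℝ)) ⊆ π '' squareCap m s := by
    intro y hy
    have hyi : ∀ i, |y i| ≤ s / u := fun i => abs_le.2 ⟨hy.1 i, hy.2 i⟩
    have hsum : ∑ i, y i ^ 2 ≤ m * (s / u) ^ 2 := by
      calc ∑ i, y i ^ 2 ≤ ∑ _i : Fin m, (s / u) ^ 2 :=
            Finset.sum_le_sum fun i _ => sq_le_sq' (abs_le.1 (hyi i)).1 (abs_le.1 (hyi i)).2
        _ = _ := by simp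
    have hinv : 1 - m * (s / u) ^ 2 = u⁻¹ ^ 2 := by
      field_simp
      rw [hu2]; ring
    set z := √(1 - ∑ i, y i ^ 2) with hz
    have hzpos : u⁻¹ ≤ z := Real.le_sqrt_of_sq_le (by linarith)
    have hz0 : 0 < z := lt_of_lt_of_le (by positivity) hzpos
    have hz2 : z ^ 2 = 1 - ∑ i, y i ^ 2 :=
      Real.sq_sqrt (by nlinarith [sq_nonneg u⁻¹])
    refine ⟨WithLp.toLp 2 (Fin.cons z y : Fin (m + 1) → ℝ), ⟨?_, ?_, fun i => ?_⟩, ?_⟩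
    · rw [EuclideanSpace.norm_eq, Fin.sum_univ_succ]
      simp [hz2]
    · simpa using hz0
    · simp only [Fin.cons_succ, Fin.cons_zero]
      calc |y i| ≤ s * u⁻¹ := by simpa [div_eq_mul_inv] using hyi i
        _ ≤ s * z := by gcongr
    · ext i; simp [hπ]
  calc ENNReal.ofReal ((2 * (s / u)) ^ m)
      = volume (Icc (fun _ => -(s / u)) (fun _ => s / u) : Set (Fin m → ℝ)) := by
        rw [Real.volume_Icc_pi]
        simp only [Finset.prod_const, Finset.card_univ, Fintype.card_fin]
        rw [← ENNReal.ofReal_pow (by rw [sub_neg_eq_add]; positivity)]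
        congr 1; ring
    _ ≤ μH[(m : ℝ)] (π '' squareCap m s) := by
        rw [hausdorffMeasure_fin_pi_real]; exact measure_mono hsub
    _ ≤ _ := by simpa using hlip.hausdorffMeasure_image_le (Nat.cast_nonneg m) (squareCap m s)

/-- On the unit sphere, the (unnormalized) Hausdorff measure is a multiple, by a constant at least
one, of the surface measure. -/
lemma exists_hausdorffMeasure_eq_smul_surfaceMeasure (m : ℕ) :
    ∃ c : ℝ, 1 ≤ c ∧ (μH[(m : ℝ)] : Measure (En (m + 1))).restrict (sphere 0 1) =
      ENNReal.ofReal c • surfaceMeasure (m + 1) := by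
  set ν := (μH[(m : ℝ)] : Measure (En (m + 1))).restrict (sphere 0 1) with hν
  set σ := surfaceMeasure (m + 1) with hσ
  have : IsFiniteMeasure ν :=
    ⟨by rw [hν, restrict_apply_univ]; exact hausdorffMeasure_unitSphere_lt_top m⟩
  have hνinv : ∀ x y : En (m + 1), ‖x‖ = 1 → ‖y‖ = 1 → ∀ r,
      ν (closedBall x r) = ν (closedBall y r) := by
    intro x y hx hy r
    obtain ⟨g, hg⟩ := exists_linearIsometryEquiv_map_eq (hx.trans hy.symm)
    rw [hν, Measure.restrict_apply measurableSet_closedBall, Measure.restrict_apply measurableSet_closedBall,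
      ← g.toIsometryEquiv.hausdorffMeasure_image]
    congr 1
    change g '' _ = _
    rw [image_inter g.injective]
    simp [hg]
  have hσinv : ∀ x y : En (m + 1), ‖x‖ = 1 → ‖y‖ = 1 → ∀ r,
      σ (closedBall x r) = σ (closedBall y r) := by
    intro x y hx hy r
    obtain ⟨g, hg⟩ := exists_linearIsometryEquiv_map_eq (hx.trans hy.symm)
    rw [hσ, ← surfaceMeasure_image g measurableSet_closedBall]
    simp [hg]
  have hS : ∀ᵐ x ∂(ν + σ), ‖x‖ = 1 := by
    rw [ae_add_measure_iff]
    refine ⟨?_, ae_surfaceMeasure_norm_eq_one _⟩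
    filter_upwards [ae_restrict_mem isClosed_sphere.measurableSet] with x hx
    simpa using hx
  have hinv : ∀ x y : En (m + 1), ‖x‖ = 1 → ‖y‖ = 1 → ∀ r,
      (ν + σ) (closedBall x r) = (ν + σ) (closedBall y r) := by
    intro x y hx hy r
    rw [Measure.add_apply, Measure.add_apply, hνinv x y hx hy, hσinv x y hx hy]
  obtain ⟨a, ha⟩ := exists_eq_smul_of_uniform (ν + σ) ν
    (Measure.le_add_right le_rfl).absolutelyContinuous hS hinv hνinv
  obtain ⟨b, hb⟩ := exists_eq_smul_of_uniform (ν + σ) σ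
    (Measure.le_add_left le_rfl).absolutelyContinuous hS hinv hσinv
  set μ := ν + σ with hμ
  have hσ0 : σ univ ≠ 0 := by
    rw [hσ, surfaceMeasure_apply .univ, univ_inter, Ioo_smul_sphere_zero le_rfl zero_lt_one]
    have h0 : volume (ball (0 : En (m + 1)) 1 \ {0}) ≠ 0 := by
      rw [measure_sdiff_null (measure_singleton _)]
      exact (measure_ball_pos _ _ one_pos).ne'
    exact mul_ne_zero (by simp) (by simpa using h0)
  have hμ0 : μ univ ≠ 0 := by
    rw [hμ, Measure.add_apply]; simp [hσ0]
  have hb0 : b ≠ 0 := by rintro rfl; rw [hb] at hσ0; simp at hσ0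
  have hbtop : b ≠ ⊤ := by
    rintro rfl
    have : σ univ = ⊤ := by rw [hb]; simp [hμ0]
    exact measure_ne_top σ univ this
  have hatop : a ≠ ⊤ := by
    rintro rfl
    have : ν univ = ⊤ := by rw [ha]; simp [hμ0]
    exact measure_ne_top ν univ this
  have hcap : ∀ s : ℝ, 0 < s → b ≤ ENNReal.ofReal (√(1 + m * s ^ 2) ^ m) * a := by
    intro s hs
    have hu0 : 0 < √(1 + m * s ^ 2) := Real.sqrt_pos.2 (by positivity)
    have h1 := surfaceMeasure_squareCap_le m hs.le
    have h2 := le_hausdorffMeasure_squareCap m hs.le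
    have h3 : μH[(m : ℝ)] (squareCap m s) = ν (squareCap m s) := by
      rw [hν, Measure.restrict_apply (measurableSet_squareCap m s), inter_eq_self_of_subset_left]
      intro x hx
      simpa using hx.1
    have hν0 : ν (squareCap m s) ≠ 0 := by
      rw [← h3]
      refine (lt_of_lt_of_le ?_ h2).ne'
      rw [ENNReal.ofReal_pos]
      positivity
    have hC0 : μ (squareCap m s) ≠ 0 := by
      rw [hμ, Measure.add_apply]; simp [hν0]
    have h4 : σ (squareCap m s) ≤ ENNReal.ofReal (√(1 + m * s ^ 2) ^ m) * ν (squareCap m s) := by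
      refine h1.trans ?_
      rw [← h3]
      refine le_trans ?_ (mul_le_mul_right h2 _)
      rw [← ENNReal.ofReal_mul (by positivity)]
      apply ENNReal.ofReal_le_ofReal
      rw [← mul_pow]
      apply le_of_eq
      congr 1
      field_simp
    rw [hb, ha, Measure.smul_apply, Measure.smul_apply, smul_eq_mul, smul_eq_mul,
      ← mul_assoc] at h4
    exact (ENNReal.mul_le_mul_iff_left hC0 (measure_ne_top μ _)).1 h4
  have hba : b ≤ a := by
    have hlim : Tendsto (fun s : ℝ => ENNReal.ofReal (√(1 + m * s ^ 2) ^ m) * a) (𝓝[>] 0) (𝓝 a) := by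
      have h1 : Tendsto (fun s : ℝ => √(1 + m * s ^ 2) ^ m) (𝓝[>] 0) (𝓝 1) := by
        have : Continuous fun s : ℝ => √(1 + m * s ^ 2) ^ m := by fun_prop
        simpa using (this.tendsto 0).mono_left nhdsWithin_le_nhds
      have := ENNReal.Tendsto.mul_const (ENNReal.tendsto_ofReal h1) (Or.inr hatop) (b := a)
      simpa using this
    exact ge_of_tendsto hlim (eventually_mem_nhdsWithin.mono fun s hs => hcap s hs)
  refine ⟨(a / b).toReal, ?_, ?_⟩
  · rw [← ENNReal.toReal_one]
    refine ENNReal.toReal_mono (ENNReal.div_ne_top hatop hb0) ?_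
    rw [ENNReal.le_div_iff_mul_le (Or.inl hb0) (Or.inl hbtop), one_mul]
    exact hba
  · rw [ENNReal.ofReal_toReal (ENNReal.div_ne_top hatop hb0)]
    conv_rhs => rw [hb]
    rw [smul_smul, ENNReal.div_mul_cancel hb0 hbtop]
    exact ha

/-- The surface integral over a sphere of radius `R`, transported to the unit sphere. -/
lemma exists_setIntegral_sphere_eq (m : ℕ) :
    ∃ c : ℝ, 1 ≤ c ∧ ∀ R : ℝ, 0 < R → ∀ f : En (m + 1) → ℝ,
      ∫ x in sphere (0 : En (m + 1)) R, f x ∂μH[(m : ℝ)] =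
        c * R ^ m * ∫ θ, f (R • (θ : En (m + 1))) ∂(volume : Measure (En (m + 1))).toSphere := by
  obtain ⟨c, hc1, hc⟩ := exists_hausdorffMeasure_eq_smul_surfaceMeasure m
  refine ⟨c, hc1, fun R hR f => ?_⟩
  have hemb : MeasurableEmbedding fun x : En (m + 1) => R • x :=
    (Homeomorph.smulOfNeZero R hR.ne').measurableEmbedding
  have hscale : (μH[(m : ℝ)] : Measure (En (m + 1))).restrict (sphere 0 R) =
      ENNReal.ofReal (R ^ m) •
        ((μH[(m : ℝ)] : Measure (En (m + 1))).restrict (sphere 0 1)).map (fun x => R • x) := by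
    ext s hs
    have hset : s ∩ sphere 0 R = R • (((fun x => R • x) ⁻¹' s) ∩ sphere (0 : En (m + 1)) 1) := by
      ext x
      rw [Set.mem_smul_set_iff_inv_smul_mem₀ hR.ne']
      have : R • R⁻¹ • x = x := smul_inv_smul₀ hR.ne' x
      simp only [mem_inter_iff, mem_preimage, this, mem_sphere_zero_iff_norm, norm_smul, norm_inv,
        Real.norm_eq_abs, abs_of_pos hR]
      rw [inv_mul_eq_one₀ hR.ne', eq_comm (a := R)]
    rw [Measure.restrict_apply hs, Measure.smul_apply, hemb.map_apply,
      Measure.restrict_apply (hemb.measurable hs), hset,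
      Measure.hausdorffMeasure_smul₀ (Nat.cast_nonneg m) hR.ne', ENNReal.smul_def, smul_eq_mul,
      smul_eq_mul]
    congr 1
    rw [NNReal.rpow_natCast, ENNReal.ofReal, Real.toNNReal_pow hR.le]
    congr 2
    ext
    simp [abs_of_pos hR, hR.le]
  rw [hscale, integral_smul_measure, hemb.integral_map, hc, integral_smul_measure, surfaceMeasure,
    (MeasurableEmbedding.subtype_coe isClosed_sphere.measurableSet).integral_map,
    ENNReal.toReal_ofReal (by positivity), ENNReal.toReal_ofReal (by positivity), smul_eq_mul,
    smul_eq_mul]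
  ring

/-- Integration in polar coordinates. -/
lemma integral_eq_integral_sphere_Ioi {m : ℕ} {F : En (m + 1) → ℝ} (hF : Integrable F) :
    ∫ x, F x = ∫ θ, (∫ r in Ioi (0 : ℝ), r ^ m * F (r • (θ : En (m + 1))))
      ∂(volume : Measure (En (m + 1))).toSphere := by
  have hmp := (volume : Measure (En (m + 1))).measurePreserving_homeomorphUnitSphereProd
  have hemb := (homeomorphUnitSphereProd (En (m + 1))).measurableEmbedding
  have hdim : Module.finrank ℝ (En (m + 1)) - 1 = m := by simp
  rw [hdim] at hmp
  have hcoe : ∀ x : ({0}ᶜ : Set (En (m + 1))),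
      ((homeomorphUnitSphereProd (En (m + 1)) x).2 : ℝ) •
        ((homeomorphUnitSphereProd (En (m + 1)) x).1 : En (m + 1)) = x := by
    intro x
    have hx : ‖(x : En (m + 1))‖ ≠ 0 := norm_ne_zero_iff.2 x.2
    simp [smul_smul, mul_inv_cancel₀ hx]
  have hint : Integrable
      (fun q : sphere (0 : En (m + 1)) 1 × Ioi (0 : ℝ) => F ((q.2 : ℝ) • (q.1 : En (m + 1))))
      ((volume : Measure (En (m + 1))).toSphere.prod (volumeIoiPow m)) := by
    rw [← hmp.integrable_comp_emb hemb]
    have : (fun x : ({0}ᶜ : Set (En (m + 1))) => F x) =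
        (fun q : sphere (0 : En (m + 1)) 1 × Ioi (0 : ℝ) => F ((q.2 : ℝ) • (q.1 : En (m + 1)))) ∘
          homeomorphUnitSphereProd (En (m + 1)) := by
      ext x; simp only [Function.comp_apply, hcoe]
    rw [← this]
    exact (integrableOn_iff_comap_subtypeVal (measurableSet_singleton _).compl).1 hF.integrableOn
  calc ∫ x, F x = ∫ x : ({(0)}ᶜ : Set (En (m + 1))), F x ∂((volume : Measure (En (m + 1))).comap (↑)) := by
        rw [integral_subtype_comap (measurableSet_singleton _).compl F, restrict_compl_singleton]
    _ = ∫ q : sphere (0 : En (m + 1)) 1 × Ioi (0 : ℝ), F ((q.2 : ℝ) • (q.1 : En (m + 1)))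
        ∂((volume : Measure (En (m + 1))).toSphere.prod (volumeIoiPow m)) := by
        rw [← hmp.integral_comp hemb]
        simp only [hcoe]
    _ = _ := by
        rw [integral_prod _ hint]
        congr 1 with θ
        simp only [Measure.volumeIoiPow, ENNReal.ofReal]
        rw [integral_withDensity_eq_integral_smul
            ((measurable_subtype_coe.pow_const _).real_toNNReal),
          integral_subtype_comap measurableSet_Ioi
            fun a : ℝ => Real.toNNReal (a ^ m) • F (a • (θ : En (m + 1)))]
        refine setIntegral_congr_fun measurableSet_Ioi fun x hx => ?_
        rw [NNReal.smul_def, Real.coe_toNNReal _ (pow_nonneg hx.out.le _), smul_eq_mul]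

/-- A property valid almost everywhere is valid almost everywhere on almost every ray. -/
lemma ae_sphere_ae_Ioi_of_ae {m : ℕ} {P : En (m + 1) → Prop} (hP : ∀ᵐ x, P x) :
    ∀ᵐ θ : sphere (0 : En (m + 1)) 1 ∂(volume : Measure (En (m + 1))).toSphere, ∀ᵐ r ∂volume.restrict (Ioi (0 : ℝ)),
      P (r • (θ : En (m + 1))) := by
  have hmp := (volume : Measure (En (m + 1))).measurePreserving_homeomorphUnitSphereProd
  have hdim : Module.finrank ℝ (En (m + 1)) - 1 = m := by simp
  rw [hdim] at hmp
  have h1 : ∀ᵐ x : ({0}ᶜ : Set (En (m + 1))) ∂((volume : Measure (En (m + 1))).comap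
      (Subtype.val : ({0}ᶜ : Set (En (m + 1))) → En (m + 1))), P x := by
    rw [← ae_restrict_iff_subtype (measurableSet_singleton _).compl]
    exact ae_restrict_of_ae hP
  have h2 := ((hmp.symm
    (homeomorphUnitSphereProd (En (m + 1))).toMeasurableEquiv).quasiMeasurePreserving.ae h1)
  have h3 := ae_ae_of_ae_prod h2
  filter_upwards [h3] with θ hθ
  rw [volumeIoiPow, ae_withDensity_iff
    (measurable_subtype_coe.pow_const _).ennreal_ofReal] at hθ
  rw [ae_restrict_iff_subtype measurableSet_Ioi]
  filter_upwards [hθ] with r hr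
  have hr0 : (0 : ℝ) < r := r.2
  simpa using hr (by simpa using pow_pos hr0 m)

/-- Young's inequality, as the tangent line inequality for `t ↦ t ^ p`. -/
lemma rpow_tangent_le {p y z : ℝ} (hp : 1 < p) (hy : 0 ≤ y) (hz : 0 ≤ z) :
    p * z ^ (p - 1) * y - (p - 1) * z ^ p ≤ y ^ p := by
  rcases hz.eq_or_lt with rfl | hz
  · rw [Real.zero_rpow (by linarith), Real.zero_rpow (by linarith)]
    simpa using Real.rpow_nonneg hy p
  · have h := one_add_mul_self_le_rpow_one_add (s := y / z - 1)
      (by linarith [div_nonneg hy hz.le]) hp.le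
    rw [add_sub_cancel, Real.div_rpow hy hz.le, le_div_iff₀ (Real.rpow_pos_of_pos hz p)] at h
    have : z ^ p = z ^ (p - 1) * z := by
      rw [← Real.rpow_add_one hz.ne']; ring_nf
    calc _ = (1 + p * (y / z - 1)) * z ^ p := by rw [this]; field_simp; ring
      _ ≤ _ := h

/-- A Lipschitz function on the line has interval integrable derivative, whose integral is the
increment of the function. -/
lemma LipschitzWith.integral_deriv_eq_sub_and_intervalIntegrable {f : ℝ → ℝ} {K : ℝ≥0}
    (hf : LipschitzWith K f) (a b : ℝ) :
    IntervalIntegrable (deriv f) volume a b ∧ ∫ r in a..b, deriv f r = f b - f a :=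
  have h := hf.lipschitzOnWith.absolutelyContinuousOnInterval (a := a) (b := b)
  ⟨h.intervalIntegrable_deriv, h.integral_deriv_eq_sub⟩

lemma intervalIntegrable_rpow_of_one_le (γ : ℝ) {a b : ℝ} (ha : 1 ≤ a) (hb : 1 ≤ b) :
    IntervalIntegrable (fun s : ℝ => s ^ γ) volume a b := by
  refine intervalIntegral.intervalIntegrable_rpow (Or.inr fun h => ?_)
  have := h.1
  have h1 : 1 ≤ min a b := le_min ha hb
  linarith

lemma norm_gradient {n : ℕ} (v : En n → ℝ) (x : En n) : ‖gradient v x‖ = ‖fderiv ℝ v x‖ := by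
  simp [gradient]

lemma measurable_norm_gradient {n : ℕ} (v : En n → ℝ) :
    Measurable fun x => ‖gradient v x‖ := by
  simp only [norm_gradient]
  exact (measurable_fderiv ℝ v).norm

lemma integrableOn_norm_gradient_rpow {n : ℕ} {v : En n → ℝ} {K : ℝ≥0} (hv : LipschitzWith K v)
    {p : ℝ} (hp : 0 ≤ p) (R : ℝ) :
    IntegrableOn (fun x => ‖gradient v x‖ ^ p) (ball 0 R) := by
  refine Measure.integrableOn_of_bounded (M := (K : ℝ) ^ p) measure_ball_lt_top.ne
    ((measurable_norm_gradient v).pow_const p).aestronglyMeasurable ?_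
  refine Eventually.of_forall fun x => ?_
  rw [Real.norm_of_nonneg (by positivity), norm_gradient]
  exact Real.rpow_le_rpow (norm_nonneg _) (norm_fderiv_le_of_lipschitz ℝ hv) hp

/-- Polar coordinates for the integral over an annulus of a quantity of the form
`α ‖x‖ ^ (-m) ∂ᵣ v + δ ‖x‖ ^ (-q)`. -/
lemma integral_annulus_radial_deriv {m : ℕ} {v : En (m + 1) → ℝ} {K : ℝ≥0}
    (hv : LipschitzWith K v) {R : ℝ} (hR : 1 ≤ R) (α δ q γ : ℝ) (hq : q = m + γ)
    (hq0 : 0 ≤ q) :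
    let F : En (m + 1) → ℝ := (ball 0 R \ ball 0 1).indicator fun x =>
      α * (‖x‖ ^ (-(m : ℝ)) * fderiv ℝ v x (‖x‖⁻¹ • x)) + δ * ‖x‖ ^ (-q)
    Integrable F ∧ ∫ x, F x = ∫ θ : sphere (0 : En (m + 1)) 1,
      (α * (v (R • (θ : En (m + 1))) - v θ) + δ * ∫ s in (1 : ℝ)..R, s ^ (-γ))
        ∂(volume : Measure (En (m + 1))).toSphere := by
  intro F
  have hA : MeasurableSet (ball (0 : En (m + 1)) R \ ball 0 1) :=
    measurableSet_ball.diff measurableSet_ball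
  have hFint : Integrable F := by
    rw [integrable_indicator_iff hA]
    have hmd : Measurable fun x => fderiv ℝ v x (‖x‖⁻¹ • x) := by
      have h1 := measurable_fderiv ℝ v
      have h2 : Measurable fun x : En (m + 1) => ‖x‖⁻¹ • x := by fun_prop
      exact isBoundedBilinearMap_apply.continuous.measurable.comp (h1.prodMk h2)
    have hmeas : Measurable fun x : En (m + 1) =>
        α * (‖x‖ ^ (-(m : ℝ)) * fderiv ℝ v x (‖x‖⁻¹ • x)) + δ * ‖x‖ ^ (-q) := by fun_prop
    refine Measure.integrableOn_of_bounded (M := |α| * K + |δ|)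
      ((measure_mono sdiff_subset).trans_lt measure_ball_lt_top).ne hmeas.aestronglyMeasurable ?_
    filter_upwards [ae_restrict_mem hA] with x hx
    have hx1 : 1 ≤ ‖x‖ := by simpa using hx.2
    have hle : ∀ t : ℝ, 0 ≤ t → |‖x‖ ^ (-t)| ≤ 1 := fun t ht => by
      rw [abs_of_nonneg (by positivity)]
      exact Real.rpow_le_one_of_one_le_of_nonpos hx1 (by linarith)
    have hd : |fderiv ℝ v x (‖x‖⁻¹ • x)| ≤ K := by
      refine ((fderiv ℝ v x).le_opNorm _).trans ?_
      rw [norm_smul, norm_inv, norm_norm, inv_mul_cancel₀ (by linarith), mul_one]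
      exact norm_fderiv_le_of_lipschitz ℝ hv
    rw [Real.norm_eq_abs]
    refine (abs_add_le _ _).trans ?_
    rw [abs_mul, abs_mul, abs_mul]
    refine add_le_add (mul_le_mul_of_nonneg_left ?_ (abs_nonneg α))
      (mul_le_of_le_one_right (abs_nonneg δ) (hle q hq0))
    calc _ ≤ 1 * (K : ℝ) := by
          gcongr
          exact hle m (Nat.cast_nonneg m)
      _ = K := one_mul _
  refine ⟨hFint, ?_⟩
  rw [integral_eq_integral_sphere_Ioi hFint]
  refine integral_congr_ae ?_
  filter_upwards [ae_sphere_ae_Ioi_of_ae hv.ae_differentiableAt] with θ hθ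
  have hθ1 : ‖(θ : En (m + 1))‖ = 1 := by simp
  set f : ℝ → ℝ := fun r => v (r • (θ : En (m + 1))) with hf
  have hflip : LipschitzWith K f := by
    have : LipschitzWith 1 fun r : ℝ => r • (θ : En (m + 1)) :=
      LipschitzWith.of_dist_le_mul fun r s => by
        rw [dist_eq_norm, ← sub_smul, norm_smul, hθ1, dist_eq_norm]; simp
    simpa [Function.comp_def] using hv.comp this
  obtain ⟨hfi, hfe⟩ := hflip.integral_deriv_eq_sub_and_intervalIntegrable 1 R
  have hpow := intervalIntegrable_rpow_of_one_le (-γ) le_rfl hR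
  have hstep : ∀ᵐ r ∂volume.restrict (Ioi (0 : ℝ)), r ^ m * F (r • (θ : En (m + 1))) =
      (Ico 1 R).indicator (fun r => α * deriv f r + δ * r ^ (-γ)) r := by
    filter_upwards [hθ, ae_restrict_mem measurableSet_Ioi] with r hr hr0
    have hr0 : 0 < r := hr0
    have hnorm : ‖r • (θ : En (m + 1))‖ = r := by rw [norm_smul, hθ1]; simp [hr0.le]
    by_cases hrA : r ∈ Ico 1 R
    · have hmem : r • (θ : En (m + 1)) ∈ ball (0 : En (m + 1)) R \ ball 0 1 := by
        simp only [Set.mem_sdiff, mem_ball_zero_iff, hnorm, not_lt]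
        exact ⟨hrA.2, hrA.1⟩
      have hd : deriv f r = fderiv ℝ v (r • (θ : En (m + 1))) θ := by
        have h2 : HasDerivAt (fun r : ℝ => r • (θ : En (m + 1))) (θ : En (m + 1)) r := by
          simpa using (hasDerivAt_id r).smul_const (θ : En (m + 1))
        exact (hr.hasFDerivAt.comp_hasDerivAt r h2).deriv
      rw [indicator_of_mem hrA, hd]
      simp only [F, indicator_of_mem hmem, hnorm, smul_smul, inv_mul_cancel₀ hr0.ne', one_smul]
      have e1 : r ^ m * r ^ (-(m : ℝ)) = 1 := by
        rw [← Real.rpow_natCast, ← Real.rpow_add hr0]; simp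
      have e2 : r ^ m * r ^ (-q) = r ^ (-γ) := by
        rw [← Real.rpow_natCast, ← Real.rpow_add hr0, hq]; ring_nf
      rw [← e2]
      linear_combination (α * fderiv ℝ v (r • (θ : En (m + 1))) θ) * e1
    · have hmem : r • (θ : En (m + 1)) ∉ ball (0 : En (m + 1)) R \ ball 0 1 := by
        simp only [Set.mem_sdiff, mem_ball_zero_iff, hnorm, not_lt]
        exact fun h => hrA ⟨h.2, h.1⟩
      rw [indicator_of_notMem hrA]
      simp only [F, indicator_of_notMem hmem, mul_zero]
  have hsub : Ico 1 R ⊆ Ioi 0 := fun r hr => lt_of_lt_of_le one_pos hr.1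
  rw [integral_congr_ae hstep, setIntegral_indicator measurableSet_Ico,
    inter_eq_self_of_subset_right hsub,
    integral_Ico_eq_integral_Ioc, ← intervalIntegral.integral_of_le hR,
    intervalIntegral.integral_add (hfi.const_mul α) (hpow.const_mul δ),
    intervalIntegral.integral_const_mul, intervalIntegral.integral_const_mul, hfe]
  simp [hf]

lemma rpow_eq_rpow_sub_one_mul {p t : ℝ} (hp : 1 < p) (ht : 0 ≤ t) :
    t ^ p = t ^ (p - 1) * t := by
  rw [← Real.rpow_add_one' ht (by linarith), sub_add_cancel]

lemma integrable_toSphere_of_continuous {m : ℕ} {f : sphere (0 : En (m + 1)) 1 → ℝ}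
    (hf : Continuous f) : Integrable f (volume : Measure (En (m + 1))).toSphere :=
  hf.integrable_of_hasCompactSupport (HasCompactSupport.of_compactSpace f)

/-- Calibration bound: the Robin functional on a ball dominates the energy of the radial profile
with slope `a r ^ (-γ)`. -/
lemma le_integral_add_integral_sphere {m : ℕ} {p γ a u B R : ℝ} (hp : 1 < p)
    (hγ : γ * (p - 1) = m) (ha : 0 ≤ a) (hu : 0 ≤ u) (hB : 0 ≤ B) (hR : 1 ≤ R)
    (hua : u + a * (∫ s in (1 : ℝ)..R, s ^ (-γ)) = 1)
    (hBu : B * R ^ m * u ^ (p - 1) = a ^ (p - 1))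
    {v : En (m + 1) → ℝ} {K : ℝ≥0} (hv : LipschitzWith K v)
    (hv1 : ∀ x ∈ closedBall (0 : En (m + 1)) 1, v x = 1) :
    (volume : Measure (En (m + 1))).toSphere.real univ * a ^ (p - 1) ≤
      (∫ x in ball 0 R, ‖gradient v x‖ ^ p) + B * R ^ m *
        ∫ θ : sphere (0 : En (m + 1)) 1, |v (R • (θ : En (m + 1)))| ^ p
          ∂(volume : Measure (En (m + 1))).toSphere := by
  have hp0 : 0 < p - 1 := by linarith
  have hγ0 : 0 ≤ γ := (mul_nonneg_iff_of_pos_right hp0).1 (hγ ▸ Nat.cast_nonneg m)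
  have hvc := hv.continuous
  set L := ∫ s in (1 : ℝ)..R, s ^ (-γ)
  obtain ⟨hFi, hFe⟩ := integral_annulus_radial_deriv hv hR (-(p * a ^ (p - 1)))
    (-((p - 1) * a ^ p)) (γ * p) γ (by linarith) (by positivity)
  have hgrad := setIntegral_mono_on hFi.integrableOn
    (integrableOn_norm_gradient_rpow hv (by linarith : 0 ≤ p) R) measurableSet_ball
    (fun x hx => by
      by_cases hxA : x ∈ ball (0 : En (m + 1)) R \ ball 0 1
      · have hx1 : 1 ≤ ‖x‖ := by simpa using hxA.2
        have hx0 : 0 ≤ ‖x‖ := norm_nonneg x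
        rw [indicator_of_mem hxA]
        have ht := rpow_tangent_le hp (norm_nonneg (gradient v x))
          (show 0 ≤ a * ‖x‖ ^ (-γ) by positivity)
        rw [Real.mul_rpow ha (by positivity), Real.mul_rpow ha (by positivity),
          ← Real.rpow_mul hx0, ← Real.rpow_mul hx0,
          show -γ * (p - 1) = -(m : ℝ) by linarith, neg_mul] at ht
        have hd : -(fderiv ℝ v x (‖x‖⁻¹ • x)) ≤ ‖gradient v x‖ := by
          refine (neg_le_abs _).trans (((fderiv ℝ v x).le_opNorm _).trans ?_)
          rw [norm_smul, norm_inv, norm_norm, inv_mul_cancel₀ (by linarith), mul_one,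
            norm_gradient]
        have hmul := mul_le_mul_of_nonneg_left hd
          (show 0 ≤ p * (a ^ (p - 1) * ‖x‖ ^ (-(m : ℝ))) by positivity)
        linarith
      · rw [indicator_of_notMem hxA]
        positivity)
  rw [setIntegral_eq_integral_of_forall_compl_eq_zero
    (fun x hx => indicator_of_notMem (fun h => hx h.1) _), hFe] at hgrad
  refine le_trans ?_ (add_le_add_left hgrad _)
  have hi1 : Integrable (fun θ : sphere (0 : En (m + 1)) 1 =>
      -(p * a ^ (p - 1)) * (v (R • (θ : En (m + 1))) - v θ) + -((p - 1) * a ^ p) * L)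
      (volume : Measure (En (m + 1))).toSphere :=
    integrable_toSphere_of_continuous (by fun_prop)
  have hi2 : Integrable (fun θ : sphere (0 : En (m + 1)) 1 => |v (R • (θ : En (m + 1)))| ^ p)
      (volume : Measure (En (m + 1))).toSphere :=
    integrable_toSphere_of_continuous
      (Continuous.rpow_const (by fun_prop) fun _ => Or.inr (by linarith))
  rw [← integral_const_mul, ← integral_add hi1 (hi2.const_mul _), ← smul_eq_mul,
    ← integral_const]
  refine integral_mono (integrable_const _) (hi1.add (hi2.const_mul _)) fun θ => ?_
  have hθ : v θ = 1 := hv1 _ (by simp)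
  have ht := rpow_tangent_le hp (abs_nonneg (v (R • (θ : En (m + 1))))) hu
  have h2 := mul_le_mul_of_nonneg_left (le_abs_self (v (R • (θ : En (m + 1)))))
    (show 0 ≤ p * u ^ (p - 1) by positivity)
  have h3 := mul_le_mul_of_nonneg_left
    (show p * u ^ (p - 1) * v (R • (θ : En (m + 1))) - (p - 1) * u ^ p ≤
      |v (R • (θ : En (m + 1)))| ^ p by linarith)
    (show 0 ≤ B * R ^ m by positivity)
  refine le_trans (le_of_eq ?_) (add_le_add_right h3 _)
  rw [hθ, rpow_eq_rpow_sub_one_mul hp hu, rpow_eq_rpow_sub_one_mul hp ha]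
  linear_combination (p - 1) * a ^ (p - 1) * hua +
    ((p - 1) * u - p * v (R • (θ : En (m + 1)))) * hBu

lemma hasDerivAt_integral_rpow (γ : ℝ) {r : ℝ} (hr : 1 < r) :
    HasDerivAt (fun t => ∫ s in (1 : ℝ)..t, s ^ γ) (r ^ γ) r := by
  have hc : ContinuousAt (fun s : ℝ => s ^ γ) r :=
    Real.continuousAt_rpow_const r γ (Or.inl (by linarith))
  refine intervalIntegral.integral_hasDerivAt_right
    (intervalIntegrable_rpow_of_one_le γ le_rfl hr.le) ?_ hc
  exact (Measurable.pow_const measurable_id γ).stronglyMeasurable.stronglyMeasurableAtFilter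

/-- The radial profile `1 - a ∫₁^{max(1, ‖x‖)} s ^ (-γ) ds`. -/
def radialProfile (m : ℕ) (γ a : ℝ) (x : En (m + 1)) : ℝ :=
  1 - a * ∫ s in (1 : ℝ)..max 1 ‖x‖, s ^ (-γ)

lemma radialProfile_eq_one {m : ℕ} (γ a : ℝ) {x : En (m + 1)} (hx : ‖x‖ ≤ 1) :
    radialProfile m γ a x = 1 := by
  simp [radialProfile, max_eq_left hx]

lemma lipschitzWith_radialProfile (m : ℕ) {γ a : ℝ} (hγ : 0 ≤ γ) (ha : 0 ≤ a) :
    LipschitzWith a.toNNReal (radialProfile m γ a) := by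
  refine LipschitzWith.of_dist_le_mul fun x y => ?_
  have hi : ∀ z : En (m + 1), IntervalIntegrable (fun s : ℝ => s ^ (-γ)) volume 1 (max 1 ‖z‖) :=
    fun z => intervalIntegrable_rpow_of_one_le _ le_rfl (le_max_left _ _)
  have hbound : ‖∫ s in (max 1 ‖x‖)..(max 1 ‖y‖), s ^ (-γ)‖ ≤
      1 * |max 1 ‖y‖ - max 1 ‖x‖| := by
    refine intervalIntegral.norm_integral_le_of_norm_le_const fun s hs => ?_
    have h1 : 1 ≤ s := (le_min (le_max_left _ _) (le_max_left _ _)).trans hs.1.le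
    rw [Real.norm_of_nonneg (by positivity)]
    exact Real.rpow_le_one_of_one_le_of_nonpos h1 (by linarith)
  have hmax : |max 1 ‖y‖ - max 1 ‖x‖| ≤ dist x y := by
    rw [dist_comm, dist_eq_norm]
    refine le_trans ?_ (abs_norm_sub_norm_le y x)
    simpa [max_comm] using abs_max_sub_max_le_abs ‖y‖ ‖x‖ 1
  rw [Real.dist_eq, Real.coe_toNNReal a ha]
  have he : radialProfile m γ a x - radialProfile m γ a y =
      a * ∫ s in (max 1 ‖x‖)..(max 1 ‖y‖), s ^ (-γ) := by
    rw [← intervalIntegral.integral_interval_sub_left (hi y) (hi x)]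
    simp only [radialProfile]
    ring
  rw [he, abs_mul, abs_of_nonneg ha]
  refine mul_le_mul_of_nonneg_left ?_ ha
  rw [Real.norm_eq_abs] at hbound
  linarith

lemma norm_gradient_radialProfile_of_lt {m : ℕ} (γ a : ℝ) {x : En (m + 1)} (hx : ‖x‖ < 1) :
    ‖gradient (radialProfile m γ a) x‖ = 0 := by
  rw [norm_gradient]
  have h : radialProfile m γ a =ᶠ[𝓝 x] fun _ => 1 := by
    filter_upwards [(isOpen_lt continuous_norm continuous_const).mem_nhds hx] with y hy
    exact radialProfile_eq_one γ a (le_of_lt hy)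
  rw [h.fderiv_eq]
  simp

lemma norm_gradient_radialProfile_le {m : ℕ} {γ a : ℝ} (hγ : 0 ≤ γ) (ha : 0 ≤ a)
    {x : En (m + 1)} (hx : 1 ≤ ‖x‖) :
    ‖gradient (radialProfile m γ a) x‖ ≤ a * ‖x‖ ^ (-γ) := by
  rw [norm_gradient]
  rcases hx.eq_or_lt with hx | hx
  · rw [← hx, Real.one_rpow, mul_one]
    simpa [ha] using norm_fderiv_le_of_lipschitz ℝ (lipschitzWith_radialProfile m hγ ha)
      (x₀ := x)
  · have h : radialProfile m γ a =ᶠ[𝓝 x]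
        fun y => 1 - a * ∫ s in (1 : ℝ)..‖y‖, s ^ (-γ) := by
      filter_upwards [(isOpen_lt continuous_const continuous_norm).mem_nhds hx] with y hy
      rw [radialProfile, max_eq_right (le_of_lt hy)]
    have hx0 : x ≠ 0 := norm_pos_iff.1 (by linarith)
    have hn : HasFDerivAt (fun y : En (m + 1) => ‖y‖) (fderiv ℝ (fun y => ‖y‖) x) x :=
      ((contDiffAt_norm ℝ hx0 (n := 1)).differentiableAt (by simp)).hasFDerivAt
    have hd := (((hasDerivAt_integral_rpow (-γ) hx).comp_hasFDerivAt x hn).const_mul a).const_sub 1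
    have hd' := hd.fderiv
    simp only [Function.comp_def] at hd'
    rw [h.fderiv_eq, hd', norm_neg, norm_smul, norm_smul, Real.norm_of_nonneg ha,
      Real.norm_of_nonneg (by positivity)]
    refine mul_le_mul_of_nonneg_left (mul_le_of_le_one_right (by positivity) ?_) ha
    simpa using norm_fderiv_le_of_lipschitz ℝ (lipschitzWith_one_norm (E := En (m + 1))) (x₀ := x)

/-- The radial profile attains the calibration bound. -/
lemma radialProfile_integral_add_integral_sphere_le {m : ℕ} {p γ a u B R : ℝ} (hp : 1 < p)
    (hγ : γ * (p - 1) = m) (ha : 0 ≤ a) (hu : 0 ≤ u) (hR : 1 ≤ R)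
    (hua : u + a * (∫ s in (1 : ℝ)..R, s ^ (-γ)) = 1)
    (hBu : B * R ^ m * u ^ (p - 1) = a ^ (p - 1)) :
    (∫ x in ball 0 R, ‖gradient (radialProfile m γ a) x‖ ^ p) + B * R ^ m *
        ∫ θ : sphere (0 : En (m + 1)) 1, |radialProfile m γ a (R • (θ : En (m + 1)))| ^ p
          ∂(volume : Measure (En (m + 1))).toSphere ≤
      (volume : Measure (En (m + 1))).toSphere.real univ * a ^ (p - 1) := by
  have hp0 : 0 < p - 1 := by linarith
  have hγ0 : 0 ≤ γ := (mul_nonneg_iff_of_pos_right hp0).1 (hγ ▸ Nat.cast_nonneg m)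
  set L := ∫ s in (1 : ℝ)..R, s ^ (-γ) with hL
  have hv := lipschitzWith_radialProfile m hγ0 ha
  obtain ⟨hFi, hFe⟩ := integral_annulus_radial_deriv hv hR 0 (a ^ p) (γ * p) γ
    (by linarith) (by positivity)
  have hgrad := setIntegral_mono_on
    (integrableOn_norm_gradient_rpow hv (by linarith : 0 ≤ p) R) hFi.integrableOn
    measurableSet_ball
    (fun x hx => by
      by_cases hx1 : ‖x‖ < 1
      · rw [norm_gradient_radialProfile_of_lt γ a hx1, Real.zero_rpow (by linarith),
          indicator_of_notMem (by simp [hx1])]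
      · rw [indicator_of_mem (show x ∈ ball 0 R \ ball 0 1 from ⟨hx, by simpa using hx1⟩), zero_mul, zero_add, ← neg_mul,
          Real.rpow_mul (norm_nonneg x), ← Real.mul_rpow ha (by positivity)]
        exact Real.rpow_le_rpow (norm_nonneg _)
          (norm_gradient_radialProfile_le hγ0 ha (not_lt.1 hx1)) (by linarith))
  rw [setIntegral_eq_integral_of_forall_compl_eq_zero
    (fun x hx => indicator_of_notMem (fun h => hx h.1) _), hFe] at hgrad
  refine (add_le_add_left hgrad _).trans (le_of_eq ?_)
  have hb : ∀ θ : sphere (0 : En (m + 1)) 1,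
      radialProfile m γ a (R • (θ : En (m + 1))) = u := fun θ => by
    have : ‖R • (θ : En (m + 1))‖ = R := by
      rw [norm_smul, Real.norm_of_nonneg (by linarith)]; simp
    rw [radialProfile, this, max_eq_right hR, ← hL]
    linarith
  simp only [hb, zero_mul, zero_add, integral_const, smul_eq_mul, abs_of_nonneg hu]
  rw [rpow_eq_rpow_sub_one_mul hp hu, rpow_eq_rpow_sub_one_mul hp ha]
  linear_combination (volume : Measure (En (m + 1))).toSphere.real univ *
    (u * hBu + a ^ (p - 1) * hua)

/-- The Robin energy of the pair of balls of radii `1` and `R`, where `c` is the ratio between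
the Hausdorff measure and the cone measure on spheres. -/
lemma exists_robinEnergy_ball_eq (m : ℕ) : ∃ c : ℝ, 1 ≤ c ∧
    ∀ p β γ R : ℝ, 1 < p → 0 < β → γ * (p - 1) = m → 1 ≤ R →
      robinEnergy p β (closedBall (0 : En (m + 1)) 1) (ball (0 : En (m + 1)) R) =
        (volume : Measure (En (m + 1))).toSphere.real univ *
          ((β * c) ^ (1 / (p - 1)) /
            ((β * c) ^ (1 / (p - 1)) * (∫ s in (1 : ℝ)..R, s ^ (-γ)) + R ^ (-γ))) ^ (p - 1) := by
  obtain ⟨c, hc, hsphere⟩ := exists_setIntegral_sphere_eq m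
  refine ⟨c, hc, fun p β γ R hp hβ hγ hR => ?_⟩
  have hp0 : 0 < p - 1 := by linarith
  have hR0 : 0 < R := by linarith
  have hγ0 : 0 ≤ γ := (mul_nonneg_iff_of_pos_right hp0).1 (hγ ▸ Nat.cast_nonneg m)
  have hfun : ∀ v : En (m + 1) → ℝ, robinFunctional p β (ball 0 R) v =
      (∫ x in ball 0 R, ‖gradient v x‖ ^ p) + β * c * R ^ m *
        ∫ θ : sphere (0 : En (m + 1)) 1, |v (R • (θ : En (m + 1)))| ^ p
          ∂(volume : Measure (En (m + 1))).toSphere := fun v => by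
    rw [robinFunctional, frontier_ball _ hR0.ne',
      show ((m + 1 : ℕ) : ℝ) - 1 = m by push_cast; ring, hsphere R hR0]
    ring
  set L := ∫ s in (1 : ℝ)..R, s ^ (-γ) with hL
  have hL0 : 0 ≤ L := intervalIntegral.integral_nonneg hR fun s hs => by
    have := hs.1
    positivity
  have hB : 0 < β * c := by positivity
  set b := (β * c) ^ (1 / (p - 1)) with hb
  have hb0 : 0 < b := by positivity
  have hbp : b ^ (p - 1) = β * c := by
    rw [hb, ← Real.rpow_mul hB.le, one_div_mul_cancel hp0.ne', Real.rpow_one]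
  have hRγ : 0 < R ^ (-γ) := by positivity
  have hD : 0 < b * L + R ^ (-γ) := by positivity
  have hua : R ^ (-γ) / (b * L + R ^ (-γ)) + b / (b * L + R ^ (-γ)) * L = 1 := by
    field_simp
    ring
  have hBu : β * c * R ^ m * (R ^ (-γ) / (b * L + R ^ (-γ))) ^ (p - 1) =
      (b / (b * L + R ^ (-γ))) ^ (p - 1) := by
    rw [Real.div_rpow hRγ.le hD.le, Real.div_rpow hb0.le hD.le, hbp, ← Real.rpow_mul hR0.le,
      neg_mul, hγ, Real.rpow_neg hR0.le, Real.rpow_natCast]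
    field_simp
  have hlow : ∀ y ∈ robinFunctional p β (ball (0 : En (m + 1)) R) ''
      robinAdmissible (closedBall 0 1), (volume : Measure (En (m + 1))).toSphere.real univ *
        (b / (b * L + R ^ (-γ))) ^ (p - 1) ≤ y := by
    rintro y ⟨v, ⟨⟨K, hK⟩, hv⟩, rfl⟩
    rw [hfun]
    exact le_integral_add_integral_sphere hp hγ (by positivity) (by positivity) hB.le hR hua hBu
      hK hv
  have hmem : radialProfile m γ (b / (b * L + R ^ (-γ))) ∈
      robinAdmissible (closedBall (0 : En (m + 1)) 1) :=
    ⟨⟨_, lipschitzWith_radialProfile m hγ0 (by positivity)⟩,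
      fun x hx => radialProfile_eq_one _ _ (by simpa using hx)⟩
  refine le_antisymm ((csInf_le ⟨_, hlow⟩ ⟨_, hmem, rfl⟩).trans ?_)
    (le_csInf ⟨_, _, hmem, rfl⟩ hlow)
  rw [hfun]
  exact radialProfile_integral_add_integral_sphere_le hp hγ (by positivity) (by positivity) hR
    hua hBu

lemma monotoneOn_mul_integral_rpow_add_rpow {b γ : ℝ} (hγ : 0 ≤ γ) (hb : γ ≤ b) :
    MonotoneOn (fun R : ℝ => b * (∫ s in (1 : ℝ)..R, s ^ (-γ)) + R ^ (-γ)) (Ici 1) := by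
  have hpos : ∀ r ∈ Ici (1 : ℝ), 0 < r := fun r hr => lt_of_lt_of_le one_pos hr
  have hcont : ContinuousOn (fun R : ℝ => b * (∫ s in (1 : ℝ)..R, s ^ (-γ)) + R ^ (-γ))
      (Ici 1) := by
    refine ContinuousOn.add (continuousOn_const.mul fun R hR => ?_)
      (fun R hR => (Real.continuousAt_rpow_const R _
        (Or.inl (hpos R hR).ne')).continuousWithinAt)
    have h := intervalIntegral.continuousOn_primitive_interval'
      (intervalIntegrable_rpow_of_one_le (-γ) le_rfl (b := R + 1)
        (by linarith [mem_Ici.1 hR])) left_mem_uIcc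
    rw [uIcc_of_le (by linarith [mem_Ici.1 hR])] at h
    refine (h R ⟨hR, by linarith⟩).mono_of_mem_nhdsWithin ?_
    filter_upwards [self_mem_nhdsWithin, mem_nhdsWithin_of_mem_nhds
      (Iio_mem_nhds (lt_add_one R))] with r h1 h2
    exact ⟨h1, le_of_lt h2⟩
  refine monotoneOn_of_hasDerivWithinAt_nonneg (convex_Ici 1) hcont
    (f' := fun r => b * r ^ (-γ) + -γ * r ^ (-γ - 1)) (fun r hr => ?_) fun r hr => ?_
  · rw [interior_Ici] at hr
    exact (((hasDerivAt_integral_rpow (-γ) hr).const_mul b).add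
      (Real.hasDerivAt_rpow_const (Or.inl (hpos r (mem_Ici.2 (le_of_lt hr))).ne'))).hasDerivWithinAt
  · rw [interior_Ici] at hr
    have hr1 : 1 < r := hr
    have h1 : r ^ (-γ - 1) ≤ r ^ (-γ) := Real.rpow_le_rpow_of_exponent_le hr1.le (by linarith)
    have h2 : 0 < r ^ (-γ) := by positivity
    nlinarith [mul_le_mul_of_nonneg_left h1 hγ, mul_le_mul_of_nonneg_right hb h2.le]

end

/-- if `β^{1/(p-1)} ≥ (n-1)/(p-1)`, then `R ↦ E_{β,p}(B_1, B_R)` is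
non-increasing on `[1, +∞)`. -/
theorem robinEnergy_balls_antitone (n : ℕ) (hn : 2 ≤ n) (p β : ℝ) (hp : 1 < p) (hβ : 0 < β)
    (hβ' : ((n : ℝ) - 1) / (p - 1) ≤ β ^ (1 / (p - 1))) :
    AntitoneOn (fun R : ℝ => robinEnergy p β (closedBall (0 : En n) 1) (ball (0 : En n) R))
      (Set.Ici (1 : ℝ)) := by
  obtain ⟨m, rfl⟩ : ∃ m, n = m + 1 := ⟨n - 1, by omega⟩
  obtain ⟨c, hc, henergy⟩ := exists_robinEnergy_ball_eq m
  have hp0 : 0 < p - 1 := by linarith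
  rw [show ((m + 1 : ℕ) : ℝ) - 1 = m by push_cast; ring] at hβ'
  have hγ : (m : ℝ) / (p - 1) * (p - 1) = m := div_mul_cancel₀ _ hp0.ne'
  have hb : (m : ℝ) / (p - 1) ≤ (β * c) ^ (1 / (p - 1)) :=
    hβ'.trans (Real.rpow_le_rpow hβ.le (le_mul_of_one_le_right hβ.le hc) (by positivity))
  have hb0 : 0 < (β * c) ^ (1 / (p - 1)) := by positivity
  have hpos : ∀ R ∈ Ici (1 : ℝ), 0 < (β * c) ^ (1 / (p - 1)) *
      (∫ s in (1 : ℝ)..R, s ^ (-((m : ℝ) / (p - 1)))) + R ^ (-((m : ℝ) / (p - 1))) :=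
    fun R hR => by
      have hR1 : 1 ≤ R := hR
      have : 0 ≤ ∫ s in (1 : ℝ)..R, s ^ (-((m : ℝ) / (p - 1))) :=
        intervalIntegral.integral_nonneg hR1 fun s hs => by
          have := hs.1
          positivity
      positivity
  intro R hR S hS hRS
  simp only
  rw [henergy p β _ R hp hβ hγ hR, henergy p β _ S hp hβ hγ hS]
  have hmono := monotoneOn_mul_integral_rpow_add_rpow (by positivity) hb hR hS hRS
  have hposR := hpos R hR
  have hposS := hpos S hS
  exact mul_le_mul_of_nonneg_left (Real.rpow_le_rpow (by positivity)
    (div_le_div_of_nonneg_left hb0.le hposR hmono) hp0.le) measureReal_nonneg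

end
end

section
/- Let p > 1 be a real number. For all real numbers a, b ≥ 0, one has a^p − b^p ≤ (p/(p−1)) a (a^{p−1} − b^{p−1}), with equality if and only if a = b. -/
open MeasureTheory Metric Set Filter
open scoped ENNReal NNReal Topology

noncomputable section

/-- Strict Young inequality in the form given by Bernoulli's inequality at `a / b`. -/
theorem mul_rpow_sub_one_lt {p a b : ℝ} (hp : 1 < p) (ha : 0 ≤ a) (hb : 0 ≤ b) (hab : a ≠ b) :
    p * a * b ^ (p - 1) < a ^ p + (p - 1) * b ^ p := by
  rcases hb.eq_or_lt with rfl | hb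
  · have ha' : 0 < a := lt_of_le_of_ne ha hab.symm
    rw [Real.zero_rpow (by linarith), Real.zero_rpow (by linarith)]
    simpa using Real.rpow_pos_of_pos ha' p
  · have bernoulli := one_add_mul_self_lt_rpow_one_add (s := a / b - 1) (p := p)
      (by linarith [div_nonneg ha hb.le])
      (by rwa [sub_ne_zero, ne_eq, div_eq_one_iff_eq hb.ne']) hp
    rw [add_sub_cancel, Real.div_rpow ha hb.le, lt_div_iff₀ (Real.rpow_pos_of_pos hb p)]
      at bernoulli
    rw [Real.rpow_sub_one hb.ne']
    have expand : (1 + p * (a / b - 1)) * b ^ p = p * a * (b ^ p / b) - (p - 1) * b ^ p := by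
      ring
    linarith

/-- for `p > 1` and `a, b ≥ 0`,
`a^p - b^p ≤ (p/(p-1)) a (a^{p-1} - b^{p-1})`, with equality iff `a = b`. -/
theorem rpow_convexity_ineq (p : ℝ) (hp : 1 < p) (a b : ℝ) (ha : 0 ≤ a) (hb : 0 ≤ b) :
    a ^ p - b ^ p ≤ p / (p - 1) * a * (a ^ (p - 1) - b ^ (p - 1)) ∧
    (a ^ p - b ^ p = p / (p - 1) * a * (a ^ (p - 1) - b ^ (p - 1)) ↔ a = b) := by
  have hp' : 0 < p - 1 := by linarith
  have lt_of_ne (hab : a ≠ b) :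
      a ^ p - b ^ p < p / (p - 1) * a * (a ^ (p - 1) - b ^ (p - 1)) := by
    have young := mul_rpow_sub_one_lt hp ha hb hab
    have a_mul : a * a ^ (p - 1) = a ^ p := by
      rw [← Real.rpow_one_add' ha (by linarith), add_sub_cancel]
    have rhs_eq : p / (p - 1) * a * (a ^ (p - 1) - b ^ (p - 1)) =
        (p * a ^ p - p * a * b ^ (p - 1)) / (p - 1) := by
      rw [← a_mul]
      ring
    rw [rhs_eq, lt_div_iff₀ hp']
    linarith
  rcases eq_or_ne a b with rfl | hab
  · simp
  · exact ⟨(lt_of_ne hab).le, iff_of_false (lt_of_ne hab).ne hab⟩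

end
end
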